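/- arXiv:1401.6101 — 3 statements merged into one kernel-verified Lean document; each statement's English description precedes it below -/
import Mathlib

section
/- Let m ≥ 2. Then dim_ℂ V_{m,d} = 1 for 0 ≤ d ≤ k and for 2km−k ≤ d ≤ 2km, and dim_ℂ V_{m,d} = 2 for k < d < 2km−k. Consequently dim_ℂ V_m = (2m−1)(g−1). -/
set_option synthInstance.maxHeartbeats 400000
set_option maxHeartbeats 1000000

noncomputable section

open scoped TensorProduct

/-- The coordinate ring `A = ℂ[u,ε]/(ε²)` of the chart `U` of the balanced ribbon. -/
def A : Type := DualNumber (Polynomial ℂ)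

instance : CommRing A := inferInstanceAs (CommRing (DualNumber (Polynomial ℂ)))
instance : Algebra ℂ A := inferInstanceAs (Algebra ℂ (DualNumber (Polynomial ℂ)))

def uu : A := TrivSqZeroExt.inl Polynomial.X
def ee : A := DualNumber.eps

/-- The restrictions to `U` of the standard basis of `H⁰(ω)` of the balanced ribbon. -/
def x (k i : ℕ) : A :=
  if i ≤ k then uu ^ i else uu ^ i + ((i - k : ℕ) : A) * uu ^ (i - k - 1) * ee

/-- `V_m`: the span of the degree-`m` monomials in `x_0, …, x_{2k}`. -/
def V (k m : ℕ) : Submodule ℂ A :=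
  Submodule.span ℂ {a | ∃ f : Fin m → ℕ, (∀ j, f j ≤ 2 * k) ∧ a = ∏ j, x k (f j)}

/-- `V_{m,d}`: the span of the degree-`m` monomials of `u`-weight `d`. -/
def Vd (k m d : ℕ) : Submodule ℂ A :=
  Submodule.span ℂ
    {a | ∃ f : Fin m → ℕ, (∀ j, f j ≤ 2 * k) ∧ (∑ j, f j) = d ∧ a = ∏ j, x k (f j)}

theorem ee_mul_ee : ee * ee = 0 := DualNumber.eps_mul_eps

/-- The general shape of a monomial of `u`-weight `d`. -/
def mon (k d s : ℕ) : A := uu ^ d + (s : A) * uu ^ (d - k - 1) * ee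

/-- The total excess over `k` of a tuple of indices. -/
def excess (k : ℕ) {m : ℕ} (f : Fin m → ℕ) : ℕ := ∑ j, (f j - k)

theorem x_eq_mon (k i : ℕ) : x k i = mon k i (i - k) := by
  unfold x mon
  split_ifs with h
  · simp [Nat.sub_eq_zero_of_le h]
  · rfl

theorem mon_mul_mon (k a b s t : ℕ) (hs : s ≠ 0 → k < a) (ht : t ≠ 0 → k < b) :
    mon k a s * mon k b t = mon k (a + b) (s + t) := by
  have h1 : (s : A) * uu ^ (a - k - 1) * uu ^ b = s * uu ^ (a + b - k - 1) := by
    by_cases h : s = 0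
    · simp [h]
    · rw [mul_assoc, ← pow_add]
      congr 2
      have := hs h
      omega
  have h2 : (t : A) * uu ^ (b - k - 1) * uu ^ a = t * uu ^ (a + b - k - 1) := by
    by_cases h : t = 0
    · simp [h]
    · rw [mul_assoc, ← pow_add]
      congr 2
      have := ht h
      omega
  unfold mon
  push_cast
  linear_combination ee * h1 + ee * h2
    + (s : A) * uu ^ (a - k - 1) * t * uu ^ (b - k - 1) * ee_mul_ee

theorem prod_x {k : ℕ} {m : ℕ} (f : Fin m → ℕ) :
    ∏ j, x k (f j) = mon k (∑ j, f j) (excess k f) := by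
  have key : ∀ s : Finset (Fin m),
      ∏ j ∈ s, x k (f j) = mon k (∑ j ∈ s, f j) (∑ j ∈ s, (f j - k)) := by
    intro s
    induction s using Finset.induction_on with
    | empty => simp [mon]
    | insert a s ha ih =>
      rw [Finset.prod_insert ha, Finset.sum_insert ha, Finset.sum_insert ha, ih, x_eq_mon]
      apply mon_mul_mon
      · omega
      · intro h
        obtain ⟨j, hj, hj'⟩ := Finset.exists_ne_zero_of_sum_ne_zero h
        have := Finset.single_le_sum (f := f) (fun i _ => Nat.zero_le _) hj
        omega
  exact key Finset.univ

theorem mon_mem_Vd {k m : ℕ} (f : Fin m → ℕ) (hf : ∀ j, f j ≤ 2 * k) :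
    mon k (∑ j, f j) (excess k f) ∈ Vd k m (∑ j, f j) :=
  Submodule.subset_span ⟨f, hf, rfl, (prod_x f).symm⟩

theorem sum_le_of_le {k m : ℕ} (f : Fin m → ℕ) (hf : ∀ j, f j ≤ 2 * k) :
    ∑ j, f j ≤ 2 * k * m := by
  have := Finset.sum_le_card_nsmul Finset.univ f (2 * k) (fun j _ => hf j)
  simpa [mul_comm] using this

theorem exists_sum_eq (k : ℕ) : ∀ (m d : ℕ), d ≤ 2 * k * m →
    ∃ f : Fin m → ℕ, (∀ j, f j ≤ 2 * k) ∧ ∑ j, f j = d := by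
  intro m
  induction m with
  | zero => intro d hd; exact ⟨fun _ => 0, by simp, by simp at hd ⊢; omega⟩
  | succ m ih =>
    intro d hd
    rw [Nat.mul_succ] at hd
    obtain ⟨f, hf, hs⟩ := ih (d - min d (2 * k)) (by omega)
    refine ⟨Fin.cons (min d (2 * k)) f, ?_, ?_⟩
    · intro j
      refine Fin.cases ?_ (fun i => ?_) j
      · simp
      · simpa using hf i
    · rw [Fin.sum_cons, hs]
      omega

theorem excess_eq_zero {k m : ℕ} (f : Fin m → ℕ) (h : ∑ j, f j ≤ k) : excess k f = 0 := by
  refine Finset.sum_eq_zero fun j hj => ?_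
  have := Finset.single_le_sum (f := f) (fun i _ => Nat.zero_le _) hj
  omega

theorem excess_add_mul {k m : ℕ} (f : Fin m → ℕ) (hf : ∀ j, f j ≤ 2 * k)
    (h : 2 * k * m ≤ ∑ j, f j + k) : excess k f + k * m = ∑ j, f j := by
  have hsum : ∑ j, (2 * k - f j) + ∑ j, f j = 2 * k * m := by
    rw [← Finset.sum_add_distrib]
    rw [Finset.sum_congr rfl fun j _ => Nat.sub_add_cancel (hf j)]
    simp [mul_comm]
  have hk : ∀ j, k ≤ f j := by
    intro j
    have := Finset.single_le_sum (f := fun j => 2 * k - f j) (fun i _ => Nat.zero_le _)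
      (Finset.mem_univ j)
    have := hf j
    omega
  have : k * m = ∑ _j : Fin m, k := by simp [mul_comm]
  rw [this, excess, ← Finset.sum_add_distrib]
  exact Finset.sum_congr rfl fun j _ => Nat.sub_add_cancel (hk j)

theorem exists_excess_eq_succ {k m d : ℕ} (hm : 2 ≤ m) (h1 : k < d)
    (h2 : d < 2 * k * m - k) : ∃ f g : Fin m → ℕ, (∀ j, f j ≤ 2 * k) ∧ (∀ j, g j ≤ 2 * k) ∧
      ∑ j, f j = d ∧ ∑ j, g j = d ∧ excess k g = excess k f + 1 := by
  obtain ⟨n, rfl⟩ := Nat.exists_eq_add_of_le' hm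
  have hk : 0 < k := by
    by_contra! hk
    simp [Nat.le_zero.1 hk] at h2
  have hn : 2 * k * (n + 2) = 2 * k * n + 4 * k := by ring
  rw [hn] at h2
  obtain ⟨r, hr, hr1, hr2⟩ : ∃ r, r ≤ 2 * k * n ∧ k + 1 + r ≤ d ∧ d ≤ 3 * k - 1 + r :=
    ⟨min (d - k - 1) (2 * k * n), min_le_right _ _, by omega, by
      generalize 2 * k * n = N at *
      omega⟩
  obtain ⟨p, hp, hs⟩ := exists_sum_eq k n r hr
  have cons_le : ∀ a b, a ≤ 2 * k → b ≤ 2 * k →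
      ∀ j, (Fin.cons a (Fin.cons b p : Fin (n + 1) → ℕ) : Fin (n + 2) → ℕ) j ≤ 2 * k := by
    intro a b ha hb j
    refine Fin.cases (by simpa using ha) (fun i => ?_) j
    refine Fin.cases (by simpa using hb) (fun l => ?_) i
    simpa using hp l
  have cons_sum : ∀ a b,
      ∑ j, (Fin.cons a (Fin.cons b p : Fin (n + 1) → ℕ) : Fin (n + 2) → ℕ) j = a + (b + r) := by
    intro a b
    rw [Fin.sum_cons, Fin.sum_cons, hs]
  have cons_excess : ∀ a b,
      excess k (Fin.cons a (Fin.cons b p : Fin (n + 1) → ℕ) : Fin (n + 2) → ℕ)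
        = (a - k) + ((b - k) + excess k p) := by
    intro a b
    simp [excess, Fin.sum_univ_succ]
  by_cases hd : d ≤ 2 * k + r
  · refine ⟨_, _, cons_le k (d - r - k) ?_ ?_, cons_le (k + 1) (d - r - k - 1) ?_ ?_,
      (cons_sum _ _).trans ?_, (cons_sum _ _).trans ?_, ?_⟩
    on_goal 7 => rw [cons_excess, cons_excess]
    all_goals omega
  · refine ⟨_, _, cons_le k (d - r - k) ?_ ?_, cons_le (k - 1) (d - r - k + 1) ?_ ?_,
      (cons_sum _ _).trans ?_, (cons_sum _ _).trans ?_, ?_⟩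
    on_goal 7 => rw [cons_excess, cons_excess]
    all_goals omega

/-- Projection of `A` onto the reduced part, as a linear map. -/
def fstA : A →ₗ[ℂ] Polynomial ℂ :=
  (TrivSqZeroExt.fstHom ℂ (Polynomial ℂ) (Polynomial ℂ)).toLinearMap

/-- Inclusion of the nilpotent part of `A`, as a linear map. -/
def inrA : Polynomial ℂ →ₗ[ℂ] A :=
  (TrivSqZeroExt.inrHom (Polynomial ℂ) (Polynomial ℂ)).restrictScalars ℂ

/-- Inclusion of the reduced part of `A`, as a ring homomorphism. -/
def inlA : Polynomial ℂ →+* A := TrivSqZeroExt.inlHom (Polynomial ℂ) (Polynomial ℂ)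

theorem uu_pow (d : ℕ) : uu ^ d = inlA (Polynomial.X ^ d) :=
  (map_pow inlA Polynomial.X d).symm

theorem uu_pow_mul_ee (d : ℕ) : uu ^ d * ee = inrA (Polynomial.X ^ d) := by
  rw [uu_pow]
  refine (TrivSqZeroExt.inl_mul_inr (Polynomial.X ^ d) (1 : Polynomial ℂ)).trans ?_
  rw [smul_eq_mul, mul_one]
  rfl

theorem fstA_inrA (p : Polynomial ℂ) : fstA (inrA p) = 0 := 
  TrivSqZeroExt.fst_inr (Polynomial ℂ) p

theorem mon_eq (k d s : ℕ) : mon k d s = uu ^ d + (s : ℂ) • (uu ^ (d - k - 1) * ee) := by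
  rw [mon, mul_assoc, Nat.cast_smul_eq_nsmul, nsmul_eq_mul]

theorem fstA_mon (k d s : ℕ) : fstA (mon k d s) = Polynomial.X ^ d := by
  rw [mon_eq, map_add, map_smul, uu_pow_mul_ee, fstA_inrA, smul_zero, add_zero, uu_pow]
  rfl

/-- Spanning vectors of the weight spaces: the first summand lists one monomial-shaped element in
each weight, the second one the nilpotent elements `u ^ j * ε`. -/
def weightVec (k m : ℕ) : ℕ ⊕ ℕ → A :=
  Sum.elim (fun d => mon k d (d - k * m)) (fun j => uu ^ j * ee)

theorem linearIndependent_X_pow :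
    LinearIndependent ℂ (fun d : ℕ => (Polynomial.X ^ d : Polynomial ℂ)) := by
  convert (Polynomial.basisMonomials ℂ).linearIndependent using 1
  ext1 d
  simp [Polynomial.X_pow_eq_monomial]

theorem linearIndependent_weightVec (k m : ℕ) : LinearIndependent ℂ (weightVec k m) := by
  have h : LinearIndependent ℂ (fstA ∘ fun d => mon k d (d - k * m)) := by
    convert linearIndependent_X_pow using 1
    ext1 d
    exact fstA_mon _ _ _
  refine LinearIndependent.sum_type (h.of_comp fstA) ?_ ?_
  · have : (fun j => uu ^ j * ee) = inrA ∘ fun d : ℕ => (Polynomial.X ^ d : Polynomial ℂ) := by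
      ext1 j
      exact uu_pow_mul_ee j
    rw [this]
    exact linearIndependent_X_pow.map' inrA
      (LinearMap.ker_eq_bot.2 TrivSqZeroExt.inr_injective)
  · refine (Submodule.range_ker_disjoint h).mono_right (Submodule.span_le.2 ?_)
    rintro _ ⟨j, rfl⟩
    simp only [SetLike.mem_coe, LinearMap.mem_ker, uu_pow_mul_ee, fstA_inrA]

theorem mon_eq_weightVec (k m d s : ℕ) : mon k d s = weightVec k m (Sum.inl d) +
    ((s : ℂ) - ((d - k * m : ℕ) : ℂ)) • weightVec k m (Sum.inr (d - k - 1)) := by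
  simp only [weightVec, Sum.elim_inl, Sum.elim_inr, mon_eq, sub_smul]
  abel

theorem Vd_eq_span_singleton {k m d : ℕ} (hm : 2 ≤ m) (hd : d ≤ 2 * k * m)
    (h : d ≤ k ∨ 2 * k * m - k ≤ d) :
    Vd k m d = Submodule.span ℂ {weightVec k m (Sum.inl d)} := by
  have key : ∀ f : Fin m → ℕ, (∀ j, f j ≤ 2 * k) → ∑ j, f j = d →
      ∏ j, x k (f j) = weightVec k m (Sum.inl d) := by
    rintro f hf rfl
    rw [prod_x]
    have : excess k f = ∑ j, f j - k * m := by
      rcases h with h | h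
      · have : k ≤ k * m := Nat.le_mul_of_pos_right _ (by omega)
        rw [excess_eq_zero f h]
        omega
      · have := excess_add_mul f hf (by omega)
        omega
    rw [this]
    rfl
  unfold Vd
  congr 1
  ext a
  constructor
  · rintro ⟨f, hf, hs, rfl⟩
    exact key f hf hs
  · rintro rfl
    obtain ⟨f, hf, hs⟩ := exists_sum_eq k m d hd
    exact ⟨f, hf, hs, (key f hf hs).symm⟩

theorem Vd_eq_span_pair {k m d : ℕ} (hm : 2 ≤ m) (h1 : k < d) (h2 : d < 2 * k * m - k) :
    Vd k m d = Submodule.span ℂ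
      {weightVec k m (Sum.inl d), weightVec k m (Sum.inr (d - k - 1))} := by
  apply le_antisymm
  · refine Submodule.span_le.2 ?_
    rintro _ ⟨f, hf, rfl, rfl⟩
    rw [prod_x, mon_eq_weightVec k m]
    exact Submodule.add_mem _ (Submodule.subset_span (by simp))
      (Submodule.smul_mem _ _ (Submodule.subset_span (by simp)))
  · obtain ⟨f, g, hf, hg, hfs, hgs, he⟩ := exists_excess_eq_succ hm h1 h2
    have mf := mon_mem_Vd f hf
    have mg := mon_mem_Vd g hg
    rw [hfs] at mf
    rw [hgs, he] at mg
    have hr : weightVec k m (Sum.inr (d - k - 1)) ∈ Vd k m d := by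
      convert Submodule.sub_mem _ mg mf using 1
      rw [mon_eq, mon_eq]
      push_cast
      rw [add_smul, one_smul]
      simp only [weightVec, Sum.elim_inr]
      abel
    have hl : weightVec k m (Sum.inl d) ∈ Vd k m d := by
      rw [mon_eq_weightVec k m] at mf
      exact (Submodule.add_mem_iff_left _ (Submodule.smul_mem _ _ hr)).1 mf
    refine Submodule.span_le.2 ?_
    rintro _ (rfl | rfl)
    exacts [hl, hr]

theorem Vd_le_V (k m d : ℕ) : Vd k m d ≤ V k m := by
  refine Submodule.span_mono ?_
  rintro _ ⟨f, hf, -, rfl⟩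
  exact ⟨f, hf, rfl⟩

/-- The index set of a basis of `V_m` inside the family `weightVec`. -/
def indexEmb (p q : ℕ) : Fin p ⊕ Fin q → ℕ ⊕ ℕ := Sum.map (↑) (↑)

theorem indexEmb_injective (p q : ℕ) : Function.Injective (indexEmb p q) :=
  Sum.map_injective.2 ⟨Fin.val_injective, Fin.val_injective⟩

theorem V_eq_span {k m : ℕ} (hm : 2 ≤ m) : V k m = Submodule.span ℂ (Set.range
    (weightVec k m ∘ indexEmb (2 * k * m + 1) (2 * k * m - 2 * k - 1))) := by
  have hkm : 2 * k * 2 ≤ 2 * k * m := Nat.mul_le_mul_left _ hm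
  apply le_antisymm
  · refine Submodule.span_le.2 ?_
    rintro _ ⟨f, hf, rfl⟩
    have hd := sum_le_of_le f hf
    have hmem : ∏ j, x k (f j) ∈ Vd k m (∑ j, f j) := Submodule.subset_span ⟨f, hf, rfl, rfl⟩
    generalize ∑ j, f j = d at hd hmem
    revert hmem
    generalize ∏ j, x k (f j) = a
    revert a
    change Vd k m d ≤ _
    by_cases h : d ≤ k ∨ 2 * k * m - k ≤ d
    · rw [Vd_eq_span_singleton hm hd h]
      refine Submodule.span_mono ?_
      rintro _ rfl
      exact ⟨Sum.inl ⟨d, by omega⟩, rfl⟩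
    · rw [Vd_eq_span_pair hm (by omega) (by omega)]
      refine Submodule.span_mono ?_
      rintro _ (rfl | rfl)
      · exact ⟨Sum.inl ⟨d, by omega⟩, rfl⟩
      · exact ⟨Sum.inr ⟨d - k - 1, by omega⟩, rfl⟩
  · refine Submodule.span_le.2 ?_
    rintro _ ⟨⟨d, hd⟩ | ⟨j, hj⟩, rfl⟩
    · refine Vd_le_V k m d ?_
      change weightVec k m (Sum.inl d) ∈ _
      by_cases h : d ≤ k ∨ 2 * k * m - k ≤ d
      · rw [Vd_eq_span_singleton hm (by omega) h]
        exact Submodule.subset_span rfl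
      · rw [Vd_eq_span_pair hm (by omega) (by omega)]
        exact Submodule.subset_span (by simp)
    · refine Vd_le_V k m (j + k + 1) ?_
      change weightVec k m (Sum.inr j) ∈ _
      rw [Vd_eq_span_pair hm (by omega) (by omega)]
      exact Submodule.subset_span (by simp [show j + k + 1 - k - 1 = j by omega])

theorem finrank_Vd_eq_one {k m d : ℕ} (hm : 2 ≤ m) (hd : d ≤ 2 * k * m)
    (h : d ≤ k ∨ 2 * k * m - k ≤ d) : Module.finrank ℂ ↥(Vd k m d) = 1 := by
  rw [Vd_eq_span_singleton hm hd h]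
  exact finrank_span_singleton ((linearIndependent_weightVec k m).ne_zero _)

/-- Weight-space dimensions of `H⁰(ω^m)` of the balanced ribbon (`g = 2k+1`):
`dim V_{m,d} = 1` for `0 ≤ d ≤ k` and `2km−k ≤ d ≤ 2km`, `dim V_{m,d} = 2` for
`k < d < 2km−k`; consequently `dim V_m = (2m−1)(g−1)`. -/
theorem stmt_2 (k m : ℕ) (hk : 2 ≤ k) (hm : 2 ≤ m) :
    (∀ d, d ≤ k → Module.finrank ℂ ↥(Vd k m d) = 1) ∧
    (∀ d, 2 * k * m - k ≤ d → d ≤ 2 * k * m → Module.finrank ℂ ↥(Vd k m d) = 1) ∧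
    (∀ d, k < d → d < 2 * k * m - k → Module.finrank ℂ ↥(Vd k m d) = 2) ∧
    Module.finrank ℂ ↥(V k m) = (2 * m - 1) * ((2 * k + 1) - 1) := by
  have hkm : 2 * k * 2 ≤ 2 * k * m := Nat.mul_le_mul_left _ hm
  have li := linearIndependent_weightVec k m
  refine ⟨fun d hd => finrank_Vd_eq_one hm (by omega) (Or.inl hd),
    fun d hd hd' => finrank_Vd_eq_one hm hd' (Or.inr hd), fun d h1 h2 => ?_, ?_⟩
  · have hinj : Function.Injective ![Sum.inl d, (Sum.inr (d - k - 1) : ℕ ⊕ ℕ)] := by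
      simp [Function.Injective, Fin.forall_fin_two]
    have hspan := finrank_span_eq_card (li.comp _ hinj)
    rw [Set.range_comp, Matrix.range_cons_cons_empty, Set.image_pair, Fintype.card_fin] at hspan
    rw [Vd_eq_span_pair hm h1 h2, hspan]
  · rw [V_eq_span hm, finrank_span_eq_card (li.comp _ (indexEmb_injective _ _))]
    simp only [Fintype.card_sum, Fintype.card_fin, Nat.add_sub_cancel]
    rw [Nat.sub_mul]
    have : 2 * m * (2 * k) = 2 * (2 * k * m) := by ring
    omega
end
end

section
/- Let m ≥ 2 and let B be a finite set of degree-m monomials in x_0,…,x_{2k} (formally, a finite set of size-m multisets of indices from {0,…,2k}, each determining the corresponding product in A). Then the images in A of the elements of B form a basis of V_m if and only if: (1) for every d with 0 ≤ d ≤ k or 2km−k ≤ d ≤ 2km, B contains exactly one monomial of u-weight d; and (2) for every d with k < d < 2km−k, B contains exactly two monomials of u-weight d, and the images of these two monomials in A are linearly independent over ℂ. -/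
set_option synthInstance.maxHeartbeats 400000
set_option maxHeartbeats 1000000

noncomputable section

open scoped TensorProduct

/-- The product in `A` of the monomial determined by a multiset of indices. -/
def mprod (k : ℕ) (s : Multiset ℕ) : A := (s.map (x k)).prod

section SingleFamilies

variable {K E ι : Type*} [Field K] [AddCommGroup E] [Module K E] (wt : ι → ℕ) (w : ι → E)

theorem linearIndepOn_piSingle_iff (B : Finset ι) :
    LinearIndepOn K (fun i => (Pi.single (wt i) (w i) : ℕ → E)) (B : Set ι) ↔
      ∀ d, LinearIndepOn K w (B.filter fun i => wt i = d : Finset ι) := by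
  classical
  constructor
  · intro h d
    have h1 : LinearIndepOn K (fun i => (Pi.single (wt i) (w i) : ℕ → E))
        (B.filter fun i => wt i = d : Finset ι) := h.mono (by exact_mod_cast Finset.filter_subset _ _)
    rw [linearIndepOn_finset_iff] at h1 ⊢
    intro f hf
    refine h1 f ?_
    have h2 : ∀ i ∈ B.filter (fun i => wt i = d),
        f i • (Pi.single (wt i) (w i) : ℕ → E) = LinearMap.single K (fun _ => E) d (f i • w i) := by
      intro i hi
      rw [(Finset.mem_filter.1 hi).2, map_smul]
      rfl
    rw [Finset.sum_congr rfl h2, ← map_sum, hf, map_zero]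
  · intro h
    rw [linearIndepOn_finset_iff]
    intro f hf i hi
    refine linearIndepOn_finset_iff.1 (h (wt i)) f ?_ i (by simp [hi])
    have h1 := congrFun hf (wt i)
    rw [Finset.sum_apply] at h1
    rw [Finset.sum_filter, ← Pi.zero_apply (M := fun _ : ℕ => E) (wt i)]
    refine Eq.trans ?_ h1
    refine Finset.sum_congr rfl fun j _ => ?_
    by_cases hj : wt j = wt i
    · simp [hj]
    · simp [hj, Ne.symm hj]

theorem span_piSingle_le_iff (S T : Set ι) :
    Submodule.span K ((fun i => (Pi.single (wt i) (w i) : ℕ → E)) '' S) ≤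
        Submodule.span K ((fun i => (Pi.single (wt i) (w i) : ℕ → E)) '' T) ↔
      ∀ d, Submodule.span K (w '' {i ∈ S | wt i = d}) ≤
        Submodule.span K (w '' {i ∈ T | wt i = d}) := by
  classical
  constructor
  · intro h d
    have hT : Submodule.span K ((fun i => (Pi.single (wt i) (w i) : ℕ → E)) '' T) ≤
        (Submodule.span K (w '' {i ∈ T | wt i = d})).comap (LinearMap.proj d) := by
      rw [Submodule.span_le]
      rintro _ ⟨i, hi, rfl⟩
      by_cases hd : wt i = d
      · subst hd
        have hm : w i ∈ w '' {j ∈ T | wt j = wt i} := ⟨i, ⟨hi, rfl⟩, rfl⟩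
        simpa using Submodule.subset_span hm
      · simp [Ne.symm hd]
    rw [Submodule.span_le]
    rintro _ ⟨i, ⟨hi, rfl⟩, rfl⟩
    simpa using hT (h (Submodule.subset_span ⟨i, hi, rfl⟩))
  · intro h
    rw [Submodule.span_le]
    rintro _ ⟨i, hi, rfl⟩
    have hT : Submodule.span K (w '' {j ∈ T | wt j = wt i}) ≤
        (Submodule.span K ((fun i => (Pi.single (wt i) (w i) : ℕ → E)) '' T)).comap
          (LinearMap.single K (fun _ => E) (wt i)) := by
      rw [Submodule.span_le]
      rintro _ ⟨j, ⟨hj, hji⟩, rfl⟩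
      exact Submodule.subset_span ⟨j, hj, by simp [hji]⟩
    exact hT (h (wt i) (Submodule.subset_span ⟨i, ⟨hi, rfl⟩, rfl⟩))

theorem span_piSingle_eq_iff (S T : Set ι) :
    Submodule.span K ((fun i => (Pi.single (wt i) (w i) : ℕ → E)) '' S) =
        Submodule.span K ((fun i => (Pi.single (wt i) (w i) : ℕ → E)) '' T) ↔
      ∀ d, Submodule.span K (w '' {i ∈ S | wt i = d}) =
        Submodule.span K (w '' {i ∈ T | wt i = d}) := by
  simp only [le_antisymm_iff, span_piSingle_le_iff, forall_and]

theorem linearIndepOn_and_span_eq_iff_card (B : Finset ι) {U : Submodule K E}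
    [FiniteDimensional K E] (hU : Submodule.span K (w '' (B : Set ι)) ≤ U) :
    (LinearIndepOn K w (B : Set ι) ∧ Submodule.span K (w '' (B : Set ι)) = U) ↔
      LinearIndepOn K w (B : Set ι) ∧ B.card = Module.finrank K U := by
  refine and_congr_right fun h => ?_
  have hc : Module.finrank K (Submodule.span K (w '' (B : Set ι))) = B.card := by
    have := finrank_span_eq_card (R := K) (b := fun i : (B : Set ι) => w i) h
    rw [Set.image_eq_range, this]
    simp
  exact ⟨fun e => by rw [← hc, e], fun e => Submodule.eq_of_le_of_finrank_eq hU (hc.trans e)⟩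

end SingleFamilies

/-- The `ε`-coefficient of the monomial `s`. -/
def epsCoeff (k : ℕ) (s : Multiset ℕ) : ℕ := (s.map fun i => i - k).sum

/-- Coordinates on `A`, with the `ε`-part shifted so that each monomial is concentrated in its
weight. -/
def weightCoords (k : ℕ) : A →ₗ[ℂ] (ℕ → ℂ × ℂ) where
  toFun a n := ((TrivSqZeroExt.fst (R := Polynomial ℂ) (M := Polynomial ℂ) a).coeff n,
    (Polynomial.X ^ (k + 1) * TrivSqZeroExt.snd (R := Polynomial ℂ) (M := Polynomial ℂ) a).coeff n)
  map_add' a b := by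
    funext n
    have h1 : TrivSqZeroExt.fst (R := Polynomial ℂ) (M := Polynomial ℂ) (a + b) =
      TrivSqZeroExt.fst (R := Polynomial ℂ) (M := Polynomial ℂ) a +
        TrivSqZeroExt.fst (R := Polynomial ℂ) (M := Polynomial ℂ) b := rfl
    have h2 : TrivSqZeroExt.snd (R := Polynomial ℂ) (M := Polynomial ℂ) (a + b) =
      TrivSqZeroExt.snd (R := Polynomial ℂ) (M := Polynomial ℂ) a +
        TrivSqZeroExt.snd (R := Polynomial ℂ) (M := Polynomial ℂ) b := rfl
    simp [h1, h2, mul_add]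
  map_smul' c a := by
    funext n
    have h1 : TrivSqZeroExt.fst (R := Polynomial ℂ) (M := Polynomial ℂ) (c • a) =
      c • TrivSqZeroExt.fst (R := Polynomial ℂ) (M := Polynomial ℂ) a := rfl
    have h2 : TrivSqZeroExt.snd (R := Polynomial ℂ) (M := Polynomial ℂ) (c • a) =
      c • TrivSqZeroExt.snd (R := Polynomial ℂ) (M := Polynomial ℂ) a := rfl
    simp [h1, h2]

theorem weightCoords_injective (k : ℕ) : Function.Injective (weightCoords k) := by
  intro a b h
  refine TrivSqZeroExt.ext (R := Polynomial ℂ) (M := Polynomial ℂ) ?_ ?_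
  · ext n
    exact congrArg Prod.fst (congrFun h n)
  · refine mul_left_cancel₀ (pow_ne_zero (k + 1) Polynomial.X_ne_zero) ?_
    ext n
    exact congrArg Prod.snd (congrFun h n)

theorem x_eq_inl_add_inr (k i : ℕ) :
    x k i = (TrivSqZeroExt.inl (Polynomial.X ^ i) +
      TrivSqZeroExt.inr (((i - k : ℕ) : Polynomial ℂ) * Polynomial.X ^ (i - k - 1)) :
        DualNumber (Polynomial ℂ)) := by
  have hu : ∀ j, uu ^ j =
      (TrivSqZeroExt.inl (Polynomial.X ^ j) : DualNumber (Polynomial ℂ)) := by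
    intro j
    induction j with
    | zero => exact pow_zero uu
    | succ j ih =>
      refine (pow_succ uu j).trans ((congrArg (· * uu) ih).trans ?_)
      exact (TrivSqZeroExt.inl_mul_inl (M := Polynomial ℂ) _ _).trans
        (congrArg _ (pow_succ _ j).symm)
  have hc : ((i - k : ℕ) : A) =
      (TrivSqZeroExt.inl ((i - k : ℕ) : Polynomial ℂ) : DualNumber (Polynomial ℂ)) :=
    (TrivSqZeroExt.inl_natCast (M := Polynomial ℂ) _).symm
  have key : ∀ a b c : DualNumber (Polynomial ℂ), a = TrivSqZeroExt.inl (Polynomial.X ^ i) →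
      b = TrivSqZeroExt.inl ((i - k : ℕ) : Polynomial ℂ) →
      c = TrivSqZeroExt.inl (Polynomial.X ^ (i - k - 1)) →
      a + b * c * TrivSqZeroExt.inr 1 = TrivSqZeroExt.inl (Polynomial.X ^ i) +
        TrivSqZeroExt.inr (((i - k : ℕ) : Polynomial ℂ) * Polynomial.X ^ (i - k - 1)) := by
    rintro _ _ _ rfl rfl rfl
    rw [← TrivSqZeroExt.inl_mul, TrivSqZeroExt.inl_mul_inr, smul_eq_mul, mul_one]
  unfold x
  split_ifs with h
  · refine (hu i).trans ?_
    simp [Nat.sub_eq_zero_of_le h]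
  · exact key _ _ _ (hu _) hc (hu _)

theorem mprod_components (k : ℕ) (s : Multiset ℕ) :
    TrivSqZeroExt.fst (R := Polynomial ℂ) (M := Polynomial ℂ) (mprod k s) = Polynomial.X ^ s.sum ∧
      Polynomial.X ^ (k + 1) *
          TrivSqZeroExt.snd (R := Polynomial ℂ) (M := Polynomial ℂ) (mprod k s) =
        (epsCoeff k s : Polynomial ℂ) * Polynomial.X ^ s.sum := by
  induction s using Multiset.induction_on with
  | empty =>
    have h : mprod k 0 = (1 : DualNumber (Polynomial ℂ)) := by
      simp only [mprod, Multiset.map_zero, Multiset.prod_zero]; rfl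
    rw [h]
    simp [epsCoeff]
  | cons i s ih =>
    have h : mprod k (i ::ₘ s) = ((TrivSqZeroExt.inl (Polynomial.X ^ i) +
      TrivSqZeroExt.inr (((i - k : ℕ) : Polynomial ℂ) * Polynomial.X ^ (i - k - 1))) *
        (show DualNumber (Polynomial ℂ) from mprod k s) : DualNumber (Polynomial ℂ)) := by
      rw [← x_eq_inl_add_inr]
      simp only [mprod, Multiset.map_cons, Multiset.prod_cons]; rfl
    have hc : epsCoeff k (i ::ₘ s) = (i - k) + epsCoeff k s := by simp [epsCoeff]
    have hx : (Polynomial.X : Polynomial ℂ) ^ (k + 1) *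
        (((i - k : ℕ) : Polynomial ℂ) * Polynomial.X ^ (i - k - 1)) =
          ((i - k : ℕ) : Polynomial ℂ) * Polynomial.X ^ i := by
      rcases le_or_gt i k with hi | hi
      · simp [Nat.sub_eq_zero_of_le hi]
      · rw [mul_left_comm, ← pow_add]
        congr 2
        omega
    rw [h, hc, Multiset.sum_cons]
    constructor
    · rw [TrivSqZeroExt.fst_mul, ih.1]
      simp [pow_add]
    · rw [TrivSqZeroExt.snd_mul, ih.1]
      simp only [TrivSqZeroExt.fst_add, TrivSqZeroExt.snd_add, TrivSqZeroExt.fst_inl,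
        TrivSqZeroExt.fst_inr, TrivSqZeroExt.snd_inl, TrivSqZeroExt.snd_inr, add_zero, zero_add,
        smul_eq_mul, MulOpposite.smul_eq_mul_unop, MulOpposite.unop_op]
      push_cast
      linear_combination Polynomial.X ^ i * ih.2 + Polynomial.X ^ s.sum * hx

theorem weightCoords_mprod (k : ℕ) (s : Multiset ℕ) :
    weightCoords k (mprod k s) = Pi.single s.sum (1, (epsCoeff k s : ℂ)) := by
  funext n
  obtain ⟨h1, h2⟩ := mprod_components k s
  refine Prod.ext ?_ ?_
  · change (TrivSqZeroExt.fst (R := Polynomial ℂ) (M := Polynomial ℂ) (mprod k s)).coeff n = _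
    rw [h1, Polynomial.coeff_X_pow, Pi.single_apply]
    split_ifs <;> rfl
  · change (Polynomial.X ^ (k + 1) *
      TrivSqZeroExt.snd (R := Polynomial ℂ) (M := Polynomial ℂ) (mprod k s)).coeff n = _
    rw [h2, Polynomial.coeff_natCast_mul, Polynomial.coeff_X_pow, Pi.single_apply]
    split_ifs <;> simp

/-- The degree-`m` monomials in `x_0, …, x_{2k}`. -/
def monomials (k m : ℕ) : Set (Multiset ℕ) := {s | Multiset.card s = m ∧ ∀ i ∈ s, i ≤ 2 * k}

theorem V_eq_span_monomials (k m : ℕ) : V k m = Submodule.span ℂ (mprod k '' monomials k m) := by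
  unfold V
  congr 1
  ext a
  constructor
  · rintro ⟨f, hf, rfl⟩
    refine ⟨Finset.univ.val.map f, ⟨by simp, by simpa using hf⟩, ?_⟩
    simp only [mprod, Multiset.map_map]
    rfl
  · rintro ⟨s, ⟨hs, hi⟩, rfl⟩
    induction s using Quotient.inductionOn with
    | h l =>
      have hl : l.length = m := by simpa using hs
      subst hl
      refine ⟨fun j => l.get j, fun j => hi _ (by simp), ?_⟩
      simp only [mprod, Multiset.quot_mk_to_coe, Multiset.map_coe, Multiset.prod_coe]
      rw [← List.prod_ofFn]
      congr 1
      exact (List.ofFn_getElem_eq_map l (x k)).symm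

theorem exists_mem_monomials_sum_eq (k n r : ℕ) (hr : r ≤ 2 * k * n) :
    ∃ s ∈ monomials k n, s.sum = r := by
  induction n generalizing r with
  | zero => exact ⟨0, by simp [monomials], by simp at hr ⊢; omega⟩
  | succ n ih =>
    obtain ⟨s, ⟨hs, hi⟩, hsum⟩ := ih (r - min r (2 * k)) (by rw [mul_add] at hr; omega)
    refine ⟨min r (2 * k) ::ₘ s, ⟨by simp [hs], ?_⟩, by simp [hsum]⟩
    intro i h
    rcases Multiset.mem_cons.1 h with rfl | h
    · exact min_le_right _ _
    · exact hi i h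

theorem exists_epsCoeff_ne (k m d : ℕ) (hm : 2 ≤ m) (h1 : k < d) (h2 : d < 2 * k * m - k) :
    ∃ s ∈ monomials k m, ∃ t ∈ monomials k m, s.sum = d ∧ t.sum = d ∧
      epsCoeff k s ≠ epsCoeff k t := by
  obtain ⟨n, rfl⟩ := Nat.exists_eq_add_of_le' hm
  have hk : 0 < k := Nat.pos_of_ne_zero (by rintro rfl; simp at h2)
  rw [mul_add] at h2
  obtain ⟨p, hp1, hp2, hp3, hp4⟩ : ∃ p, k < p ∧ p < 3 * k ∧ p ≤ d ∧ d - p ≤ 2 * k * n :=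
    ⟨max (k + 1) (d - 2 * k * n), by omega, by omega, by omega, by omega⟩
  obtain ⟨r, ⟨hr, hi⟩, hsum⟩ := exists_mem_monomials_sum_eq k n (d - p) hp4
  have mem : ∀ a b, a ≤ 2 * k → b ≤ 2 * k → a ::ₘ b ::ₘ r ∈ monomials k (n + 2) := by
    intro a b ha hb
    refine ⟨by simp [hr], fun i h => ?_⟩
    simp only [Multiset.mem_cons] at h
    rcases h with rfl | rfl | h
    exacts [ha, hb, hi i h]
  refine ⟨_, mem k (p - k) (by omega) (by omega),
    _, mem (min p (2 * k)) (p - min p (2 * k)) (by omega) (by omega), ?_, ?_, ?_⟩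
  · simp [hsum]; omega
  · simp [hsum]; omega
  · simp [epsCoeff]; omega

theorem epsCoeff_eq_zero_of_sum_le {k : ℕ} {s : Multiset ℕ} (h : s.sum ≤ k) :
    epsCoeff k s = 0 := by
  refine Multiset.sum_eq_zero fun j hj => ?_
  obtain ⟨i, hi, rfl⟩ := Multiset.mem_map.1 hj
  exact Nat.sub_eq_zero_of_le ((Multiset.le_sum_of_mem hi).trans h)

theorem sum_le_of_mem_monomials {k m : ℕ} {s : Multiset ℕ} (hs : s ∈ monomials k m) :
    s.sum ≤ 2 * k * m := by
  have := Multiset.sum_le_card_nsmul s (2 * k) hs.2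
  rw [hs.1, smul_eq_mul] at this
  linarith

theorem epsCoeff_eq_of_le_sum {k m : ℕ} {s : Multiset ℕ} (hs : s ∈ monomials k m)
    (h : 2 * k * m - k ≤ s.sum) : epsCoeff k s = s.sum - k * m := by
  have hk : ∀ i ∈ s, k ≤ i := by
    intro i hi
    obtain ⟨t, rfl⟩ := Multiset.exists_cons_of_mem hi
    have ht : t ∈ monomials k (m - 1) :=
      ⟨by simp [← hs.1], fun j hj => hs.2 j (Multiset.mem_cons_of_mem hj)⟩
    have hm : m = (m - 1) + 1 := by have := hs.1; simp at this; omega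
    have := sum_le_of_mem_monomials ht
    rw [hm, mul_add, Multiset.sum_cons] at h
    omega
  have key : epsCoeff k s + k * m = s.sum := by
    rw [← hs.1]
    clear hs h
    induction s using Multiset.induction_on with
    | empty => simp [epsCoeff]
    | cons i s ih =>
      have h1 := ih fun j hj => hk j (Multiset.mem_cons_of_mem hj)
      have h2 := hk i (Multiset.mem_cons_self i s)
      simp only [epsCoeff, Multiset.map_cons, Multiset.sum_cons, Multiset.card_cons, mul_add] at *
      omega
  omega

/-- The nonzero coordinate of `weightCoords k (mprod k s)`. -/
def coordPair (k : ℕ) (s : Multiset ℕ) : ℂ × ℂ := (1, (epsCoeff k s : ℂ))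

theorem coordPair_ne_zero (k : ℕ) (s : Multiset ℕ) : coordPair k s ≠ 0 := by
  simp [coordPair, Prod.ext_iff]

theorem finrank_span_coordPair_of_const {k m d : ℕ} (hd : d ≤ 2 * k * m)
    (h : ∀ s ∈ monomials k m, ∀ t ∈ monomials k m, s.sum = d → t.sum = d →
      epsCoeff k s = epsCoeff k t) :
    Module.finrank ℂ (Submodule.span ℂ (coordPair k '' {s ∈ monomials k m | s.sum = d})) = 1 := by
  obtain ⟨s, hs, hsum⟩ := exists_mem_monomials_sum_eq k m d hd
  have : coordPair k '' {s ∈ monomials k m | s.sum = d} = {coordPair k s} := by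
    refine Set.eq_singleton_iff_unique_mem.2 ⟨⟨s, ⟨hs, hsum⟩, rfl⟩, ?_⟩
    rintro _ ⟨t, ⟨ht, htsum⟩, rfl⟩
    rw [coordPair, coordPair, h t ht s hs htsum hsum]
  rw [this, finrank_span_singleton (coordPair_ne_zero k s)]

theorem finrank_span_coordPair_of_ne {k m d : ℕ} (hm : 2 ≤ m) (h1 : k < d)
    (h2 : d < 2 * k * m - k) :
    Module.finrank ℂ (Submodule.span ℂ (coordPair k '' {s ∈ monomials k m | s.sum = d})) = 2 := by
  obtain ⟨s, hs, t, ht, hsd, htd, hne⟩ := exists_epsCoeff_ne k m d hm h1 h2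
  have htop : Submodule.span ℂ (coordPair k '' {s ∈ monomials k m | s.sum = d}) = ⊤ := by
    rw [eq_top_iff]
    rintro ⟨a, b⟩ -
    have hne' : (epsCoeff k t : ℂ) - epsCoeff k s ≠ 0 :=
      sub_ne_zero.2 (by exact_mod_cast hne.symm)
    set q : ℂ := (b - a * epsCoeff k s) / ((epsCoeff k t : ℂ) - epsCoeff k s) with hq
    have hab : ((a, b) : ℂ × ℂ) = (a - q) • coordPair k s + q • coordPair k t := by
      refine Prod.ext ?_ ?_
      · simp [coordPair]
      · simp only [coordPair, Prod.snd_add, Prod.smul_snd, smul_eq_mul]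
        have : q * ((epsCoeff k t : ℂ) - epsCoeff k s) = b - a * epsCoeff k s :=
          div_mul_cancel₀ _ hne'
        linear_combination -this
    rw [hab]
    exact add_mem (Submodule.smul_mem _ _ (Submodule.subset_span ⟨s, ⟨hs, hsd⟩, rfl⟩))
      (Submodule.smul_mem _ _ (Submodule.subset_span ⟨t, ⟨ht, htd⟩, rfl⟩))
  rw [htop, finrank_top, Module.finrank_prod, Module.finrank_self]

theorem basis_iff_card_filter (k m : ℕ) (B : Finset (Multiset ℕ)) (hB : ↑B ⊆ monomials k m) :
    (LinearIndepOn ℂ (mprod k) (B : Set (Multiset ℕ)) ∧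
        Submodule.span ℂ (mprod k '' ↑B) = V k m) ↔
      ∀ d, LinearIndepOn ℂ (mprod k) (B.filter fun s => s.sum = d : Finset (Multiset ℕ)) ∧
        (B.filter fun s => s.sum = d).card =
          Module.finrank ℂ
            (Submodule.span ℂ (coordPair k '' {s ∈ monomials k m | s.sum = d})) := by
  have hφ : (weightCoords k) ∘ mprod k =
      fun s => (Pi.single s.sum (coordPair k s) : ℕ → ℂ × ℂ) := funext (weightCoords_mprod k)
  have hLI : ∀ C : Finset (Multiset ℕ), LinearIndepOn ℂ (mprod k) (C : Set (Multiset ℕ)) ↔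
      ∀ d, LinearIndepOn ℂ (coordPair k) (C.filter fun s => s.sum = d : Finset _) := by
    intro C
    rw [← linearIndepOn_piSingle_iff Multiset.sum, ← hφ]
    exact ((weightCoords k).linearIndepOn_iff_of_injOn (weightCoords_injective k).injOn).symm
  have hLId : ∀ d, LinearIndepOn ℂ (mprod k) (B.filter fun s => s.sum = d : Finset _) ↔
      LinearIndepOn ℂ (coordPair k) (B.filter fun s => s.sum = d : Finset _) := by
    intro d
    rw [hLI]
    constructor
    · intro h
      simpa [Finset.filter_filter] using h d
    · intro h e
      exact h.mono (by exact_mod_cast Finset.filter_subset _ _)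
  have hspan : Submodule.span ℂ (mprod k '' ↑B) = V k m ↔
      ∀ d, Submodule.span ℂ (coordPair k '' (B.filter fun s => s.sum = d : Finset _)) =
        Submodule.span ℂ (coordPair k '' {s ∈ monomials k m | s.sum = d}) := by
    have := span_piSingle_eq_iff (K := ℂ) Multiset.sum (coordPair k) (B : Set (Multiset ℕ))
      (monomials k m)
    rw [← hφ, Set.image_comp, Set.image_comp, Submodule.span_image, Submodule.span_image,
      (Submodule.map_injective_of_injective (weightCoords_injective k)).eq_iff,
      ← V_eq_span_monomials] at this
    simpa using this
  rw [hLI, hspan, ← forall_and]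
  refine forall_congr' fun d => ?_
  rw [hLId]
  refine linearIndepOn_and_span_eq_iff_card _ _ (Submodule.span_mono (Set.image_mono ?_))
  intro s hs
  have := Finset.mem_filter.1 (Finset.mem_coe.1 hs)
  exact ⟨hB this.1, this.2⟩

/-- Criterion for a set `B` of degree-`m` monomials to form a basis of `V_m`. -/
theorem stmt_3 (k m : ℕ) (hk : 2 ≤ k) (hm : 2 ≤ m)
    (B : Finset (Multiset ℕ))
    (hB : ∀ s ∈ B, Multiset.card s = m ∧ ∀ i ∈ s, i ≤ 2 * k) :
    (LinearIndependent ℂ (fun s : B => mprod k (s : Multiset ℕ)) ∧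
        Submodule.span ℂ (mprod k '' ↑B) = V k m) ↔
      ((∀ d, (d ≤ k ∨ (2 * k * m - k ≤ d ∧ d ≤ 2 * k * m)) →
          (B.filter fun s => s.sum = d).card = 1) ∧
       (∀ d, k < d → d < 2 * k * m - k →
          (B.filter fun s => s.sum = d).card = 2 ∧
          ∀ s ∈ B, ∀ t ∈ B, s.sum = d → t.sum = d → s ≠ t →
            LinearIndependent ℂ ![mprod k s, mprod k t])) := by
  have hB' : (B : Set (Multiset ℕ)) ⊆ monomials k m := fun s hs => hB s hs
  refine (basis_iff_card_filter k m B hB').trans ?_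
  have hkm : 2 * k ≤ k * m := by nlinarith
  have hkm' : 2 * k * m = 2 * (k * m) := by ring
  have hlow : ∀ d, (d ≤ k ∨ (2 * k * m - k ≤ d ∧ d ≤ 2 * k * m)) → Module.finrank ℂ
      (Submodule.span ℂ (coordPair k '' {s ∈ monomials k m | s.sum = d})) = 1 := by
    intro d hd
    refine finrank_span_coordPair_of_const (by omega) fun s hs t ht hsd htd => ?_
    rcases hd with hd | hd
    · rw [epsCoeff_eq_zero_of_sum_le (hsd.trans_le hd), epsCoeff_eq_zero_of_sum_le (htd.trans_le hd)]
    · rw [epsCoeff_eq_of_le_sum hs (by omega), epsCoeff_eq_of_le_sum ht (by omega), hsd, htd]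
  have hpair : ∀ s t, s ≠ t → (LinearIndepOn ℂ (mprod k) {s, t} ↔
      LinearIndependent ℂ ![mprod k s, mprod k t]) := by
    intro s t hst
    rw [LinearIndepOn.pair_iff _ hst, LinearIndependent.pair_iff]
  constructor
  · intro h
    refine ⟨fun d hd => (h d).2.trans (hlow d hd), fun d h1 h2 =>
      ⟨(h d).2.trans (finrank_span_coordPair_of_ne hm h1 h2), ?_⟩⟩
    intro s hs t ht hsd htd hst
    refine (hpair s t hst).1 ((h d).1.mono ?_)
    rintro _ (rfl | rfl)
    · simp [hs, hsd]
    · simp [ht, htd]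
  · rintro ⟨h1, h2⟩ d
    by_cases hd : d ≤ k ∨ (2 * k * m - k ≤ d ∧ d ≤ 2 * k * m)
    · refine ⟨?_, (h1 d hd).trans (hlow d hd).symm⟩
      obtain ⟨s, hs⟩ := Finset.card_eq_one.1 (h1 d hd)
      rw [hs, Finset.coe_singleton, linearIndepOn_singleton_iff]
      intro h0
      have := weightCoords_mprod k s
      rw [h0, map_zero] at this
      exact coordPair_ne_zero k s (Pi.single_eq_zero_iff.1 this.symm)
    by_cases hd2 : d < 2 * k * m - k
    · obtain ⟨hc, hli⟩ := h2 d (by omega) hd2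
      refine ⟨?_, hc.trans (finrank_span_coordPair_of_ne hm (by omega) hd2).symm⟩
      obtain ⟨s, t, hst, he⟩ := Finset.card_eq_two.1 hc
      have hs : s ∈ B.filter fun s => s.sum = d := by simp [he]
      have ht : t ∈ B.filter fun s => s.sum = d := by simp [he]
      rw [Finset.mem_filter] at hs ht
      rw [he, Finset.coe_pair, hpair s t hst]
      exact hli s hs.1 t ht.1 hs.2 ht.2 hst
    · have hlarge : ∀ s ∈ monomials k m, s.sum ≠ d := fun s hs h => by
        have := sum_le_of_mem_monomials hs
        omega
      have hBd : (B.filter fun s => s.sum = d) = ∅ :=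
        Finset.filter_eq_empty_iff.2 fun s hs => hlarge s (hB' hs)
      have hMd : {s ∈ monomials k m | s.sum = d} = ∅ :=
        Set.eq_empty_iff_forall_notMem.2 fun s hs => hlarge s hs.1 hs.2
      rw [hBd, hMd, Set.image_empty, Submodule.span_empty, finrank_bot]
      simp
end
end

section
/- For every p ≥ 1 there is a ℂ-linear isomorphism ker α_p ≅ ker f_{p+1,1} / im f_{p+2,0}, where f_{p+2,0} : ⋀^{p+2}W → (⋀^{p+1}W) ⊗ W is the Koszul differential with V_0 = ℂ·1, i.e., f_{p+2,0}(w_1∧⋯∧w_{p+2}) = Σ_{i=1}^{p+2} (−1)^{i−1} w_1∧⋯∧ŵ_i∧⋯∧w_{p+2} ⊗ w_i. -/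
set_option synthInstance.maxHeartbeats 1000000
set_option maxHeartbeats 1000000

noncomputable section

open scoped TensorProduct

/-- The `n`-th exterior power `⋀ⁿ M` of a `ℂ`-module, as a type. -/
def ExtPow (n : ℕ) (M : Type) [AddCommGroup M] [Module ℂ M] : Type := ↥(⋀[ℂ]^n M)

instance (n : ℕ) (M : Type) [AddCommGroup M] [Module ℂ M] : AddCommGroup (ExtPow n M) :=
  inferInstanceAs (AddCommGroup ↥(⋀[ℂ]^n M))
instance (n : ℕ) (M : Type) [AddCommGroup M] [Module ℂ M] : Module ℂ (ExtPow n M) :=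
  inferInstanceAs (Module ℂ ↥(⋀[ℂ]^n M))

/-- The pure wedge `v_1 ∧ ⋯ ∧ v_n ∈ ⋀ⁿ M`. -/
def wedge {M : Type} [AddCommGroup M] [Module ℂ M] (n : ℕ) (v : Fin n → M) : ExtPow n M :=
  (⟨ExteriorAlgebra.ιMulti ℂ n v,
    ExteriorAlgebra.ιMulti_range ℂ n (Set.mem_range_self v)⟩ : ↥(⋀[ℂ]^n M))

/-- The `m`-th graded piece `Sym^m W` of a model `P` of the symmetric algebra of `W`,
namely the span of the `m`-fold products of elements of `ι(W)`. -/
def SymPow {M : Type} [AddCommGroup M] [Module ℂ M] (P : Type) [CommRing P] [Algebra ℂ P]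
    (ι : M →ₗ[ℂ] P) (m : ℕ) : Submodule ℂ P :=
  Submodule.span ℂ {p | ∃ f : Fin m → M, p = ∏ j, ι (f j)}

/-- The inclusion of the `n`-th exterior power into the exterior algebra. -/
def ExtPow.incl (n : ℕ) (M : Type) [AddCommGroup M] [Module ℂ M] :
    ExtPow n M →ₗ[ℂ] ExteriorAlgebra ℂ M :=
  (⋀[ℂ]^n M).subtype

section Koszul

variable {M : Type} [AddCommGroup M] [Module ℂ M]

theorem ExtPow.incl_injective (n : ℕ) : Function.Injective (ExtPow.incl n M) :=
  Subtype.val_injective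

theorem ExtPow.range_incl (n : ℕ) : LinearMap.range (ExtPow.incl n M) = ⋀[ℂ]^n M :=
  Submodule.range_subtype _

theorem ExtPow.incl_wedge (n : ℕ) (w : Fin n → M) :
    ExtPow.incl n M (wedge n w) = ExteriorAlgebra.ιMulti ℂ n w := rfl

theorem ExtPow.span_wedge (n : ℕ) :
    Submodule.span ℂ (Set.range (wedge n : (Fin n → M) → ExtPow n M)) = ⊤ := by
  apply Submodule.map_injective_of_injective (ExtPow.incl_injective (M := M) n)
  rw [Submodule.map_span, ← Set.range_comp, Submodule.map_top, ExtPow.range_incl,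
    ← ExteriorAlgebra.ιMulti_span_fixedDegree]
  rfl

/-- Two linear maps out of `⋀ⁿ M ⊗ N` agree as soon as they agree on the tensors of a pure
wedge with an element of `N`. -/
theorem ExtPow.tensor_ext {n : ℕ} {N T : Type} [AddCommGroup N] [Module ℂ N] [AddCommGroup T]
    [Module ℂ T] {f g : ExtPow n M ⊗[ℂ] N →ₗ[ℂ] T}
    (h : ∀ (w : Fin n → M) (y : N), f (wedge n w ⊗ₜ[ℂ] y) = g (wedge n w ⊗ₜ[ℂ] y)) : f = g := by
  apply TensorProduct.ext
  apply LinearMap.ext_on_range (ExtPow.span_wedge n)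
  intro w
  ext y
  exact h w y

theorem ExteriorAlgebra.contractLeft_ι_mul (φ : Module.Dual ℂ M) (w : M)
    (x : ExteriorAlgebra ℂ M) :
    (CliffordAlgebra.contractLeft φ (ExteriorAlgebra.ι ℂ w * x) : ExteriorAlgebra ℂ M) =
      φ w • x - ExteriorAlgebra.ι ℂ w * (CliffordAlgebra.contractLeft φ x : ExteriorAlgebra ℂ M) :=
  CliffordAlgebra.contractLeft_ι_mul _ _ _

theorem ExteriorAlgebra.contractLeft_ιMulti (φ : Module.Dual ℂ M) (n : ℕ) (w : Fin (n + 1) → M) :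
    (CliffordAlgebra.contractLeft φ (ExteriorAlgebra.ιMulti ℂ (n + 1) w : ExteriorAlgebra ℂ M) :
        ExteriorAlgebra ℂ M) =
      ∑ i : Fin (n + 1), ((-1 : ℂ) ^ (i : ℕ) * φ (w i)) •
        ExteriorAlgebra.ιMulti ℂ n (fun j => w (i.succAbove j)) := by
  induction n with
  | zero =>
    rw [ExteriorAlgebra.ιMulti_succ_apply, ExteriorAlgebra.contractLeft_ι_mul]
    simp only [ExteriorAlgebra.ιMulti_zero_apply]
    have : (CliffordAlgebra.contractLeft φ (1 : ExteriorAlgebra ℂ M) : ExteriorAlgebra ℂ M) = 0 :=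
      CliffordAlgebra.contractLeft_one (0 : QuadraticForm ℂ M) φ
    simp [this]
  | succ n ih =>
    rw [ExteriorAlgebra.ιMulti_succ_apply, ExteriorAlgebra.contractLeft_ι_mul, ih]
    conv_rhs => rw [Fin.sum_univ_succ]
    have key : ∀ i : Fin (n + 1),
        ExteriorAlgebra.ιMulti ℂ (n + 1) (fun j => w (i.succ.succAbove j)) =
          ExteriorAlgebra.ι ℂ (w 0) *
            ExteriorAlgebra.ιMulti ℂ n (fun j => w (i.succAbove j).succ) := by
      intro i
      rw [ExteriorAlgebra.ιMulti_succ_apply]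
      simp [Matrix.vecTail, Function.comp_def]
    simp only [key, Finset.mul_sum, sub_eq_add_neg, ← Finset.sum_neg_distrib]
    congr 1
    · simp only [Fin.val_zero, pow_zero, one_mul, Fin.succAbove_zero]
      rfl
    · refine Finset.sum_congr rfl fun i _ => ?_
      rw [mul_smul_comm, ← neg_smul]
      simp [Matrix.vecTail, pow_succ]

variable {κ : Type} [Fintype κ] (b : Module.Basis κ ℂ M)

theorem sum_ι_mul_contractLeft_ιMulti (n : ℕ) (w : Fin n → M) :
    ∑ i, ExteriorAlgebra.ι ℂ (b i) *
        (CliffordAlgebra.contractLeft (b.coord i) (ExteriorAlgebra.ιMulti ℂ n w) :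
          ExteriorAlgebra ℂ M) =
      (n : ℂ) • ExteriorAlgebra.ιMulti ℂ n w := by
  induction n with
  | zero =>
    simp only [ExteriorAlgebra.ιMulti_zero_apply]
    simp [CliffordAlgebra.contractLeft_one]
  | succ n ih =>
    have anti : ∀ (x y : M) (z : ExteriorAlgebra ℂ M),
        ExteriorAlgebra.ι ℂ x * (ExteriorAlgebra.ι ℂ y * z) =
          -(ExteriorAlgebra.ι ℂ y * (ExteriorAlgebra.ι ℂ x * z)) := by
      intro x y z
      rw [← mul_assoc, ← mul_assoc, ← neg_mul, eq_neg_of_add_eq_zero_left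
        (ExteriorAlgebra.ι_add_mul_swap (R := ℂ) x y)]
    rw [ExteriorAlgebra.ιMulti_succ_apply]
    simp only [ExteriorAlgebra.contractLeft_ι_mul, mul_sub, Finset.sum_sub_distrib,
      mul_smul_comm, anti (b _) (w 0),
      Finset.sum_neg_distrib, ← Finset.mul_sum, ih, ← smul_mul_assoc, ← Finset.sum_mul,
      ← map_smul, ← map_sum]
    rw [show ∑ i, b.coord i (w 0) • b i = w 0 from b.sum_repr (w 0)]
    simp only [map_add, map_smul, smul_mul_assoc, Nat.cast_add, Nat.cast_one, add_smul, add_mul,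
      one_smul, sub_neg_eq_add]
    abel

variable {P : Type} [CommRing P] [Algebra ℂ P] (ι : M →ₗ[ℂ] P)

/-- The Koszul differential on `⋀ M ⊗ P` attached to a linear map `ι : M → P`, written in terms
of a basis of `M`. -/
def koszulDifferential : ExteriorAlgebra ℂ M ⊗[ℂ] P →ₗ[ℂ] ExteriorAlgebra ℂ M ⊗[ℂ] P :=
  ∑ i, TensorProduct.map (CliffordAlgebra.contractLeft (b.coord i)) (LinearMap.mulLeft ℂ (ι (b i)))

/-- The homotopy operator on `⋀ M ⊗ P` built from a family of derivations of `P`. -/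
def koszulHomotopy (D : κ → Derivation ℂ P P) :
    ExteriorAlgebra ℂ M ⊗[ℂ] P →ₗ[ℂ] ExteriorAlgebra ℂ M ⊗[ℂ] P :=
  ∑ i, TensorProduct.map (LinearMap.mulLeft ℂ (ExteriorAlgebra.ι ℂ (b i))) (D i).toLinearMap

theorem koszulDifferential_tmul (x : ExteriorAlgebra ℂ M) (f : P) :
    koszulDifferential b ι (x ⊗ₜ f) =
      ∑ i, (CliffordAlgebra.contractLeft (b.coord i) x : ExteriorAlgebra ℂ M) ⊗ₜ[ℂ]
        (ι (b i) * f) := by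
  simp [koszulDifferential, LinearMap.sum_apply]

theorem koszulHomotopy_tmul (D : κ → Derivation ℂ P P) (x : ExteriorAlgebra ℂ M) (f : P) :
    koszulHomotopy b D (x ⊗ₜ f) =
      ∑ i, (ExteriorAlgebra.ι ℂ (b i) * x) ⊗ₜ[ℂ] (D i f) := by
  simp [koszulHomotopy, LinearMap.sum_apply]

theorem koszulDifferential_comp_self :
    koszulDifferential b ι ∘ₗ koszulDifferential b ι = 0 := by
  apply TensorProduct.ext'
  intro x f
  simp only [LinearMap.comp_apply, koszulDifferential_tmul, map_sum, LinearMap.zero_apply]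
  have h : ∀ s : ExteriorAlgebra ℂ M ⊗[ℂ] P, s = -s → s = 0 := by
    intro s hs
    have h2 : (2 : ℂ) • s = 0 := by
      rw [two_smul]
      exact eq_neg_iff_add_eq_zero.mp hs
    simpa using h2
  apply h
  conv_lhs => rw [Finset.sum_comm]
  simp only [← Finset.sum_neg_distrib]
  refine Finset.sum_congr rfl fun i _ => Finset.sum_congr rfl fun j _ => ?_
  rw [← TensorProduct.neg_tmul, mul_left_comm]
  congr 1
  exact CliffordAlgebra.contractLeft_comm _ _ _

theorem koszulDifferential_ιMulti_tmul (n : ℕ) (w : Fin (n + 1) → M) (f : P) :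
    koszulDifferential b ι (ExteriorAlgebra.ιMulti ℂ (n + 1) w ⊗ₜ f) =
      ∑ i : Fin (n + 1), ((-1 : ℂ) ^ (i : ℕ)) •
        (ExteriorAlgebra.ιMulti ℂ n (fun j => w (i.succAbove j)) ⊗ₜ[ℂ] (ι (w i) * f)) := by
  rw [koszulDifferential_tmul]
  simp only [ExteriorAlgebra.contractLeft_ιMulti, TensorProduct.sum_tmul]
  rw [Finset.sum_comm]
  refine Finset.sum_congr rfl fun i _ => ?_
  conv_rhs => rw [← b.sum_repr (w i)]
  simp only [map_sum, map_smul, Finset.sum_mul, TensorProduct.tmul_sum, Finset.smul_sum,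
    smul_mul_assoc, TensorProduct.tmul_smul, mul_smul, TensorProduct.smul_tmul',
    Module.Basis.coord_apply]

theorem koszulDifferential_homotopy (D : κ → Derivation ℂ P P)
    (hD : ∀ i w, D i (ι w) = algebraMap ℂ P (b.coord i w)) (x : ExteriorAlgebra ℂ M) (f : P) :
    koszulDifferential b ι (koszulHomotopy b D (x ⊗ₜ f)) +
        koszulHomotopy b D (koszulDifferential b ι (x ⊗ₜ f)) =
      x ⊗ₜ (∑ i, ι (b i) * D i f) +
        (∑ i, ExteriorAlgebra.ι ℂ (b i) *
          (CliffordAlgebra.contractLeft (b.coord i) x : ExteriorAlgebra ℂ M)) ⊗ₜ f := by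
  classical
  simp only [koszulDifferential_tmul, koszulHomotopy_tmul, map_sum,
    ExteriorAlgebra.contractLeft_ι_mul, Derivation.leibniz, hD, smul_eq_mul,
    TensorProduct.sub_tmul, TensorProduct.tmul_add, Finset.sum_add_distrib,
    Finset.sum_sub_distrib, TensorProduct.tmul_sum, TensorProduct.sum_tmul]
  rw [Finset.sum_comm (f := fun i j => (ExteriorAlgebra.ι ℂ (b j) *
    (CliffordAlgebra.contractLeft (b.coord i) x : ExteriorAlgebra ℂ M)) ⊗ₜ[ℂ] (ι (b i) * D j f))]
  have h1 : ∀ j, ∑ i, (b.coord i (b j) • x) ⊗ₜ[ℂ] (ι (b i) * D j f) =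
      x ⊗ₜ[ℂ] (ι (b j) * D j f) := by
    intro j
    rw [Finset.sum_eq_single j]
    · simp
    · intro i _ hij
      simp [Finsupp.single_eq_of_ne hij]
    · simp
  have h2 : ∀ i, ∑ j, (ExteriorAlgebra.ι ℂ (b j) *
      (CliffordAlgebra.contractLeft (b.coord i) x : ExteriorAlgebra ℂ M)) ⊗ₜ[ℂ]
        (f * algebraMap ℂ P (b.coord j (b i))) =
      (ExteriorAlgebra.ι ℂ (b i) *
      (CliffordAlgebra.contractLeft (b.coord i) x : ExteriorAlgebra ℂ M)) ⊗ₜ[ℂ] f := by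
    intro i
    rw [Finset.sum_eq_single i]
    · simp
    · intro j _ hij
      simp [Finsupp.single_eq_of_ne hij]
    · simp
  simp only [h1, h2]
  rw [Finset.sum_comm (f := fun j i => (ExteriorAlgebra.ι ℂ (b j) *
    (CliffordAlgebra.contractLeft (b.coord i) x : ExteriorAlgebra ℂ M)) ⊗ₜ[ℂ] (ι (b i) * D j f))]
  abel

theorem euler_of_mem_symPow (D : κ → Derivation ℂ P P)
    (hD : ∀ i w, D i (ι w) = algebraMap ℂ P (b.coord i w)) (m : ℕ) {f : P}
    (hf : f ∈ SymPow P ι m) : ∑ i, ι (b i) * D i f = (m : ℂ) • f := by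
  have hι : ∀ w, ∑ i, ι (b i) * D i (ι w) = ι w := by
    intro w
    conv_rhs => rw [← b.sum_repr w]
    simp only [hD, map_sum, map_smul, Algebra.smul_def, Module.Basis.coord_apply]
    exact Finset.sum_congr rfl fun i _ => mul_comm _ _
  induction hf using Submodule.span_induction with
  | zero => simp
  | add x y _ _ hx hy => simp [mul_add, Finset.sum_add_distrib, hx, hy]
  | smul c x _ hx =>
    simp only [Derivation.map_smul, mul_smul_comm, ← Finset.smul_sum, hx]
    exact smul_comm _ _ _
  | mem x hx =>
    obtain ⟨g, rfl⟩ := hx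
    induction m with
    | zero => simp
    | succ m ih =>
      have := ih (fun j => g j.succ)
      simp only [Fin.prod_univ_succ, Derivation.leibniz, mul_add, Finset.sum_add_distrib,
        smul_eq_mul, mul_left_comm (ι (b _)), ← Finset.mul_sum, this, hι]
      rw [mul_smul_comm, Nat.cast_succ, add_smul, one_smul, mul_comm (∏ _, _)]

section Graded

variable {N N' : Type} [AddCommGroup N] [Module ℂ N] [AddCommGroup N'] [Module ℂ N']

theorem ExtPow.ι_mul_incl_mem (k : ℕ) (w : M) (x : ExtPow k M) :
    ExteriorAlgebra.ι ℂ w * ExtPow.incl k M x ∈ LinearMap.range (ExtPow.incl (k + 1) M) := by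
  rw [ExtPow.range_incl]
  change _ ∈ LinearMap.range (ExteriorAlgebra.ι ℂ : M →ₗ[ℂ] ExteriorAlgebra ℂ M) ^ (k + 1)
  rw [pow_succ']
  exact Submodule.mul_mem_mul ⟨w, rfl⟩ x.2

theorem ExtPow.sum_ι_mul_contractLeft_incl (k : ℕ) (x : ExtPow k M) :
    ∑ i, ExteriorAlgebra.ι ℂ (b i) *
        (CliffordAlgebra.contractLeft (b.coord i) (ExtPow.incl k M x) : ExteriorAlgebra ℂ M) =
      (k : ℂ) • ExtPow.incl k M x := by
  have hx : x ∈ Submodule.span ℂ (Set.range (wedge k : (Fin k → M) → ExtPow k M)) := by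
    rw [ExtPow.span_wedge]
    trivial
  induction hx using Submodule.span_induction with
  | zero => simp
  | add x y _ _ hx hy => simp only [map_add, mul_add, Finset.sum_add_distrib, hx, hy, smul_add]
  | smul c x _ hx =>
    simp only [map_smul, mul_smul_comm, ← Finset.smul_sum, hx]
    exact smul_comm _ _ _
  | mem x hx =>
    obtain ⟨w, rfl⟩ := hx
    exact sum_ι_mul_contractLeft_ιMulti b k w

/-- The Koszul differential and the homotopy operator satisfy `dh + hd = k + m` on the bidegree
`(k, m)` part of `⋀ M ⊗ P`. -/
theorem koszulDifferential_homotopy_of_mem (D : κ → Derivation ℂ P P)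
    (hD : ∀ i w, D i (ι w) = algebraMap ℂ P (b.coord i w)) (k m : ℕ) (g : N →ₗ[ℂ] P)
    (hg : ∀ y, g y ∈ SymPow P ι m) (z : ExtPow k M ⊗[ℂ] N) :
    koszulDifferential b ι (koszulHomotopy b D (TensorProduct.map (ExtPow.incl k M) g z)) +
        koszulHomotopy b D (koszulDifferential b ι (TensorProduct.map (ExtPow.incl k M) g z)) =
      ((m : ℂ) + k) • TensorProduct.map (ExtPow.incl k M) g z := by
  induction z using TensorProduct.induction_on with
  | zero => simp
  | add z z' hz hz' =>
    simp only [map_add, smul_add, ← hz, ← hz']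
    abel
  | tmul x y =>
    rw [TensorProduct.map_tmul, koszulDifferential_homotopy b ι D hD,
      euler_of_mem_symPow b ι D hD m (hg y), ExtPow.sum_ι_mul_contractLeft_incl,
      TensorProduct.tmul_smul, ← TensorProduct.smul_tmul', ← add_smul]

theorem koszulHomotopy_mem_range (D : κ → Derivation ℂ P P) (k : ℕ) (g : N →ₗ[ℂ] P)
    (g' : N' →ₗ[ℂ] P) (hg : ∀ i y, D i (g y) ∈ LinearMap.range g') (z : ExtPow k M ⊗[ℂ] N) :
    koszulHomotopy b D (TensorProduct.map (ExtPow.incl k M) g z) ∈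
      LinearMap.range (TensorProduct.map (ExtPow.incl (k + 1) M) g') := by
  induction z using TensorProduct.induction_on with
  | zero => simp
  | add z z' hz hz' =>
    simp only [map_add]
    exact add_mem hz hz'
  | tmul x y =>
    rw [TensorProduct.map_tmul, koszulHomotopy_tmul]
    refine sum_mem fun i _ => ?_
    obtain ⟨x', hx'⟩ := ExtPow.ι_mul_incl_mem k (b i) x
    obtain ⟨y', hy'⟩ := hg i y
    exact ⟨x' ⊗ₜ y', by rw [TensorProduct.map_tmul, hx', hy']⟩

theorem koszulDifferential_mem_range (k : ℕ) (g : N →ₗ[ℂ] P)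
    (g' : N' →ₗ[ℂ] P) (hg : ∀ w y, ι w * g y ∈ LinearMap.range g')
    (z : ExtPow (k + 1) M ⊗[ℂ] N) :
    koszulDifferential b ι (TensorProduct.map (ExtPow.incl (k + 1) M) g z) ∈
      LinearMap.range (TensorProduct.map (ExtPow.incl k M) g') := by
  induction z using TensorProduct.induction_on with
  | zero => simp
  | add z z' hz hz' =>
    simp only [map_add]
    exact add_mem hz hz'
  | tmul x y =>
    have hx : x ∈ Submodule.span ℂ
        (Set.range (wedge (k + 1) : (Fin (k + 1) → M) → ExtPow (k + 1) M)) := by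
      rw [ExtPow.span_wedge]
      trivial
    induction hx using Submodule.span_induction with
    | zero => simp
    | add x x' _ _ hx hx' =>
      rw [TensorProduct.add_tmul, map_add, map_add]
      exact add_mem hx hx'
    | smul c x _ hx =>
      rw [← TensorProduct.smul_tmul', map_smul, map_smul]
      exact Submodule.smul_mem _ _ hx
    | mem x hx =>
      obtain ⟨w, rfl⟩ := hx
      rw [TensorProduct.map_tmul, ExtPow.incl_wedge, koszulDifferential_ιMulti_tmul]
      refine sum_mem fun i _ => Submodule.smul_mem _ _ ?_
      obtain ⟨y', hy'⟩ := hg (w i) y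
      exact ⟨wedge k (fun j => w (i.succAbove j)) ⊗ₜ y', by
        rw [TensorProduct.map_tmul, hy', ExtPow.incl_wedge]⟩

/-- Exactness of the Koszul complex: a cycle of positive total degree is a boundary. -/
theorem exists_koszulDifferential_eq (D : κ → Derivation ℂ P P)
    (hD : ∀ i w, D i (ι w) = algebraMap ℂ P (b.coord i w)) (k m : ℕ) (hm : m ≠ 0)
    (g : N →ₗ[ℂ] P) (hg : ∀ y, g y ∈ SymPow P ι m)
    (g' : N' →ₗ[ℂ] P) (hg' : ∀ i y, D i (g y) ∈ LinearMap.range g')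
    (z : ExtPow k M ⊗[ℂ] N)
    (hz : koszulDifferential b ι (TensorProduct.map (ExtPow.incl k M) g z) = 0) :
    ∃ z' : ExtPow (k + 1) M ⊗[ℂ] N',
      koszulDifferential b ι (TensorProduct.map (ExtPow.incl (k + 1) M) g' z') =
        TensorProduct.map (ExtPow.incl k M) g z := by
  obtain ⟨t, ht⟩ := koszulHomotopy_mem_range b D k g g' hg' z
  have h := koszulDifferential_homotopy_of_mem b ι D hD k m g hg z
  rw [hz, map_zero, add_zero, ← ht] at h
  have hne : ((m : ℂ) + k) ≠ 0 := by
    exact_mod_cast (by omega : m + k ≠ 0)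
  exact ⟨((m : ℂ) + k)⁻¹ • t, by rw [map_smul, map_smul, h, inv_smul_smul₀ hne]⟩

end Graded

/-- A commutative algebra with the universal property of the symmetric algebra of `M` carries,
for every linear form on `M`, a derivation extending it. -/
theorem exists_derivation_of_universal
    (hP : ∀ (B : Type) [CommRing B] [Algebra ℂ B] (φ : M →ₗ[ℂ] B),
      ∃! ψ : P →ₐ[ℂ] B, ψ.toLinearMap ∘ₗ ι = φ) (φ : Module.Dual ℂ M) :
    ∃ D : Derivation ℂ P P, ∀ w, D (ι w) = algebraMap ℂ P (φ w) := by
  obtain ⟨ψ, hψ, -⟩ := hP (DualNumber P)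
    ((TrivSqZeroExt.inlAlgHom ℂ P P).toLinearMap ∘ₗ ι +
      (TrivSqZeroExt.inrHom P P).restrictScalars ℂ ∘ₗ Algebra.linearMap ℂ P ∘ₗ φ)
  have hψ' : ∀ w, ψ (ι w) = TrivSqZeroExt.inl (ι w) +
      TrivSqZeroExt.inr (algebraMap ℂ P (φ w)) := fun w => LinearMap.congr_fun hψ w
  have hfst : (TrivSqZeroExt.fstHom ℂ P P).comp ψ = AlgHom.id ℂ P := by
    refine (hP P ι).unique ?_ ?_
    · ext w
      simp [hψ']
    · ext w
      rfl
  have hfst' : ∀ f, (ψ f).fst = f := fun f => DFunLike.congr_fun hfst f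
  refine ⟨Derivation.mk' ((TrivSqZeroExt.sndHom P P).restrictScalars ℂ ∘ₗ ψ.toLinearMap) ?_, ?_⟩
  · intro f g
    simp [hfst', mul_comm]
  · intro w
    simp [hψ', Algebra.algebraMap_eq_smul_one]

end Koszul

theorem LinearMap.exists_surjective_of_range_eq {R K L T : Type} [CommRing R] [AddCommGroup K]
    [Module R K] [AddCommGroup L] [Module R L] [AddCommGroup T] [Module R T] (g : K →ₗ[R] T)
    (j : L →ₗ[R] T) (hj : Function.Injective j) (h : LinearMap.range g = LinearMap.range j) :
    ∃ θ : K →ₗ[R] L, Function.Surjective θ ∧ LinearMap.ker θ = LinearMap.ker g := by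
  have hg : ∀ x, g x ∈ LinearMap.range j := fun x => h ▸ LinearMap.mem_range_self g x
  set θ : K →ₗ[R] L := (LinearEquiv.ofInjective j hj).symm.toLinearMap ∘ₗ g.codRestrict _ hg
  have hθ : ∀ x, j (θ x) = g x := fun x =>
    congrArg Subtype.val ((LinearEquiv.ofInjective j hj).apply_symm_apply ⟨g x, hg x⟩)
  refine ⟨θ, fun y => ?_, ?_⟩
  · obtain ⟨x, hx⟩ : j y ∈ LinearMap.range g := h ▸ LinearMap.mem_range_self j y
    exact ⟨x, hj (by rw [hθ, hx])⟩
  · ext x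
    rw [LinearMap.mem_ker, LinearMap.mem_ker, ← hθ, map_eq_zero_iff j hj]

/-- **Lemma 2.2** (`ker α ≃ K_{p+1,1}`), stated for `p = n + 1 ≥ 1`.  Here `A` is a
commutative `ℂ`-algebra, `W ⊆ A` a finite-dimensional subspace, `P` (a model of) the
symmetric algebra `Sym W` (via the universal property `hP`), `μ : Sym W → A` the
multiplication map, `I_m = ker (μ_m : Sym^m W → A)`, `V_m = im μ_m`; `f0 = f_{p+2,0}`,
`f1 = f_{p+1,1}` are the Koszul differentials and `alpha = α_p` (each characterized on
generators, after composing with the injection of the relevant subspace of the target).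
Conclusion: `ker α_p ≅ ker f_{p+1,1} / im f_{p+2,0}` as `ℂ`-vector spaces. -/
theorem stmt_7
    (Alg : Type) [CommRing Alg] [Algebra ℂ Alg]
    (W : Submodule ℂ Alg) [FiniteDimensional ℂ ↥W]
    (P : Type) [CommRing P] [Algebra ℂ P] (ι : ↥W →ₗ[ℂ] P)
    (hP : ∀ (B : Type) [CommRing B] [Algebra ℂ B] (φ : ↥W →ₗ[ℂ] B),
      ∃! ψ : P →ₐ[ℂ] B, ψ.toLinearMap ∘ₗ ι = φ)
    (μ : P →ₐ[ℂ] Alg) (hμ : μ.toLinearMap ∘ₗ ι = W.subtype)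
    (n : ℕ)
    (f0 : ExtPow (n + 3) ↥W →ₗ[ℂ] (ExtPow (n + 2) ↥W ⊗[ℂ] ↥W))
    (hf0 : ∀ w : Fin (n + 3) → ↥W,
      f0 (wedge (n + 3) w) =
        ∑ i : Fin (n + 3), ((-1 : ℂ) ^ (i : ℕ)) •
          (wedge (n + 2) (fun j => w (i.succAbove j)) ⊗ₜ[ℂ] w i))
    (f1 : (ExtPow (n + 2) ↥W ⊗[ℂ] ↥W) →ₗ[ℂ]
      (ExtPow (n + 1) ↥W ⊗[ℂ] ↥(Submodule.map μ.toLinearMap (SymPow P ι 2))))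
    (hf1 : ∀ (w : Fin (n + 2) → ↥W) (y : ↥W),
      (LinearMap.lTensor (ExtPow (n + 1) ↥W)
          (Submodule.map μ.toLinearMap (SymPow P ι 2)).subtype)
        (f1 (wedge (n + 2) w ⊗ₜ[ℂ] y)) =
        ∑ i : Fin (n + 2), ((-1 : ℂ) ^ (i : ℕ)) •
          (wedge (n + 1) (fun j => w (i.succAbove j)) ⊗ₜ[ℂ] ((w i : Alg) * (y : Alg))))
    (alpha : (ExtPow (n + 1) ↥W ⊗[ℂ] ↥(SymPow P ι 2 ⊓ LinearMap.ker μ.toLinearMap)) →ₗ[ℂ]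
      (ExtPow n ↥W ⊗[ℂ] ↥(SymPow P ι 3 ⊓ LinearMap.ker μ.toLinearMap)))
    (halpha : ∀ (w : Fin (n + 1) → ↥W)
        (q : ↥(SymPow P ι 2 ⊓ LinearMap.ker μ.toLinearMap)),
      (LinearMap.lTensor (ExtPow n ↥W)
          (SymPow P ι 3 ⊓ LinearMap.ker μ.toLinearMap).subtype)
        (alpha (wedge (n + 1) w ⊗ₜ[ℂ] q)) =
        ∑ i : Fin (n + 1), ((-1 : ℂ) ^ (i : ℕ)) •
          (wedge n (fun j => w (i.succAbove j)) ⊗ₜ[ℂ] (ι (w i) * (q : P)))) :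
    -- `ker α_p ≅ ker f_{p+1,1} / im f_{p+2,0}`, expressed via a linear surjection
    -- `θ : ker f_{p+1,1} → ker α_p` with kernel `im f_{p+2,0}`:
    ∃ θ : ↥(LinearMap.ker f1) →ₗ[ℂ] ↥(LinearMap.ker alpha),
      Function.Surjective θ ∧
      LinearMap.ker θ =
        Submodule.comap (LinearMap.ker f1).subtype (LinearMap.range f0) := by
  have hμι : ∀ w, μ (ι w) = (w : Alg) := fun w => LinearMap.congr_fun hμ w
  have hιinj : Function.Injective ι := fun x y hxy =>
    Subtype.ext (by rw [← hμι, ← hμι, hxy])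
  set b := Module.finBasis ℂ ↥W
  choose D hD using fun i => exists_derivation_of_universal ι hP (b.coord i)
  set d := koszulDifferential b ι
  have hι1 : ∀ w, ι w ∈ SymPow P ι 1 := fun w => Submodule.subset_span ⟨fun _ => w, by simp⟩
  have hι2 : ∀ v w, ι v * ι w ∈ SymPow P ι 2 := fun v w =>
    Submodule.subset_span ⟨![v, w], by simp⟩
  have hD2 : ∀ i, ∀ f ∈ SymPow P ι 2, D i f ∈ LinearMap.range ι := by
    intro i f hf
    induction hf using Submodule.span_induction with
    | zero => simp
    | add x y _ _ hx hy =>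
      rw [map_add]
      exact add_mem hx hy
    | smul c x _ hx =>
      rw [Derivation.map_smul]
      exact Submodule.smul_mem _ _ hx
    | mem x hx =>
      obtain ⟨g, rfl⟩ := hx
      refine ⟨b.coord i (g 1) • g 0 + b.coord i (g 0) • g 1, ?_⟩
      simp only [Fin.prod_univ_two, Derivation.leibniz, hD, map_add, map_smul, smul_eq_mul,
        Algebra.smul_def]
      ring
  -- compatibility of `f0`, `f1` and `alpha` with the Koszul differential on `⋀ W ⊗ P`
  have nat0 : ∀ t : ExtPow (n + 3) ↥W ⊗[ℂ] ℂ,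
      d (TensorProduct.map (ExtPow.incl (n + 3) ↥W) (Algebra.linearMap ℂ P) t) =
        TensorProduct.map (ExtPow.incl (n + 2) ↥W) ι (f0 (TensorProduct.rid ℂ _ t)) := by
    intro t
    suffices h : d ∘ₗ TensorProduct.map (ExtPow.incl (n + 3) ↥W) (Algebra.linearMap ℂ P) =
        TensorProduct.map (ExtPow.incl (n + 2) ↥W) ι ∘ₗ f0 ∘ₗ
          (TensorProduct.rid ℂ (ExtPow (n + 3) ↥W)).toLinearMap from LinearMap.congr_fun h t
    refine ExtPow.tensor_ext fun w c => ?_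
    simp only [LinearMap.comp_apply, TensorProduct.map_tmul, ExtPow.incl_wedge, d,
      koszulDifferential_ιMulti_tmul, LinearEquiv.coe_coe, TensorProduct.rid_tmul, map_smul, hf0,
      map_sum, Finset.smul_sum, Algebra.linearMap_apply]
    refine Finset.sum_congr rfl fun i _ => ?_
    rw [smul_comm, mul_comm, ← Algebra.smul_def, TensorProduct.tmul_smul]
  have nat1 : ∀ t : ExtPow (n + 2) ↥W ⊗[ℂ] ↥W,
      LinearMap.lTensor (ExteriorAlgebra ℂ ↥W) μ.toLinearMap
          (d (TensorProduct.map (ExtPow.incl (n + 2) ↥W) ι t)) =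
        TensorProduct.map (ExtPow.incl (n + 1) ↥W)
          (Submodule.map μ.toLinearMap (SymPow P ι 2)).subtype (f1 t) := by
    intro t
    suffices h : LinearMap.lTensor (ExteriorAlgebra ℂ ↥W) μ.toLinearMap ∘ₗ d ∘ₗ
          TensorProduct.map (ExtPow.incl (n + 2) ↥W) ι =
        LinearMap.rTensor Alg (ExtPow.incl (n + 1) ↥W) ∘ₗ
          LinearMap.lTensor (ExtPow (n + 1) ↥W)
            (Submodule.map μ.toLinearMap (SymPow P ι 2)).subtype ∘ₗ f1 by
      refine (LinearMap.congr_fun h t).trans ?_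
      rw [← LinearMap.rTensor_comp_lTensor]
      rfl
    refine ExtPow.tensor_ext fun w y => ?_
    simp only [LinearMap.comp_apply, hf1, TensorProduct.map_tmul, ExtPow.incl_wedge, d,
      koszulDifferential_ιMulti_tmul, map_sum, map_smul, LinearMap.lTensor_tmul,
      LinearMap.rTensor_tmul, AlgHom.toLinearMap_apply, map_mul, hμι]
  have natα : ∀ t : ExtPow (n + 1) ↥W ⊗[ℂ] ↥(SymPow P ι 2 ⊓ LinearMap.ker μ.toLinearMap),
      d (TensorProduct.map (ExtPow.incl (n + 1) ↥W)
        (SymPow P ι 2 ⊓ LinearMap.ker μ.toLinearMap).subtype t) =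
        TensorProduct.map (ExtPow.incl n ↥W)
          (SymPow P ι 3 ⊓ LinearMap.ker μ.toLinearMap).subtype (alpha t) := by
    intro t
    suffices h : d ∘ₗ TensorProduct.map (ExtPow.incl (n + 1) ↥W)
        (SymPow P ι 2 ⊓ LinearMap.ker μ.toLinearMap).subtype =
        LinearMap.rTensor P (ExtPow.incl n ↥W) ∘ₗ
          LinearMap.lTensor (ExtPow n ↥W)
            (SymPow P ι 3 ⊓ LinearMap.ker μ.toLinearMap).subtype ∘ₗ alpha by
      refine (LinearMap.congr_fun h t).trans ?_
      rw [← LinearMap.rTensor_comp_lTensor]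
      rfl
    refine ExtPow.tensor_ext fun w y => ?_
    simp only [LinearMap.comp_apply, halpha, TensorProduct.map_tmul, ExtPow.incl_wedge, d,
      koszulDifferential_ιMulti_tmul, map_sum, map_smul, LinearMap.rTensor_tmul,
      Submodule.subtype_apply]
  have hdd : ∀ t, d (d t) = 0 := fun t =>
    LinearMap.congr_fun (koszulDifferential_comp_self b ι) t
  have inj : ∀ (k : ℕ) {N T : Type} [AddCommGroup N] [Module ℂ N] [AddCommGroup T] [Module ℂ T]
      (g : N →ₗ[ℂ] T), Function.Injective g →
      Function.Injective (TensorProduct.map (ExtPow.incl k ↥W) g) := fun k _ _ _ _ _ _ g hg =>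
    TensorProduct.map_injective_of_flat_flat _ _ (ExtPow.incl_injective k) hg
  have hrange : LinearMap.range (d ∘ₗ
      TensorProduct.map (ExtPow.incl (n + 2) ↥W) ι ∘ₗ (LinearMap.ker f1).subtype) =
      LinearMap.range (TensorProduct.map (ExtPow.incl (n + 1) ↥W)
        (SymPow P ι 2 ⊓ LinearMap.ker μ.toLinearMap).subtype ∘ₗ
          (LinearMap.ker alpha).subtype) := by
    apply le_antisymm
    · rintro _ ⟨⟨y, hy⟩, rfl⟩
      obtain ⟨s, hs⟩ := koszulDifferential_mem_range b ι (n + 1) ι (SymPow P ι 2).subtype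
        (fun v w => by
          rw [Submodule.range_subtype]
          exact hι2 v w) y
      have hexact : Function.Exact
          (Submodule.inclusion (inf_le_left :
            SymPow P ι 2 ⊓ LinearMap.ker μ.toLinearMap ≤ SymPow P ι 2))
          (μ.toLinearMap ∘ₗ (SymPow P ι 2).subtype) := by
        intro f
        constructor
        · intro hf
          exact ⟨⟨f, f.2, hf⟩, rfl⟩
        · rintro ⟨g, rfl⟩
          exact g.2.2
      have hs0 : LinearMap.lTensor (ExtPow (n + 1) ↥W)
          (μ.toLinearMap ∘ₗ (SymPow P ι 2).subtype) s = 0 := by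
        apply inj (n + 1) (LinearMap.id : Alg →ₗ[ℂ] Alg) Function.injective_id
        have h1 := nat1 y
        rw [LinearMap.mem_ker.mp hy, map_zero] at h1
        rw [map_zero, ← h1]
        change _ = LinearMap.lTensor _ _ (koszulDifferential b ι _)
        rw [← hs]
        simp only [LinearMap.lTensor, ← LinearMap.comp_apply, ← TensorProduct.map_comp,
          LinearMap.id_comp, LinearMap.comp_id]
      obtain ⟨t, rfl⟩ := (Module.Flat.lTensor_exact (ExtPow (n + 1) ↥W) hexact s).mp hs0
      have ht : TensorProduct.map (ExtPow.incl (n + 1) ↥W)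
        (SymPow P ι 2 ⊓ LinearMap.ker μ.toLinearMap).subtype t =
          d (TensorProduct.map (ExtPow.incl (n + 2) ↥W) ι y) := by
        refine Eq.trans ?_ hs
        simp only [LinearMap.lTensor, ← LinearMap.comp_apply, ← TensorProduct.map_comp,
          LinearMap.comp_id]
        rfl
      refine ⟨⟨t, ?_⟩, ht⟩
      apply inj n (SymPow P ι 3 ⊓ LinearMap.ker μ.toLinearMap).subtype
        (Submodule.subtype_injective _)
      rw [← natα, ht, hdd, map_zero]
    · rintro _ ⟨⟨x, hx⟩, rfl⟩
      obtain ⟨y, hy⟩ := exists_koszulDifferential_eq b ι D hD (n + 1) 2 two_ne_zero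
        (SymPow P ι 2 ⊓ LinearMap.ker μ.toLinearMap).subtype
        (fun f => f.2.1) ι (fun i f => hD2 i f f.2.1) x
        ((natα x).trans (by rw [LinearMap.mem_ker.mp hx, map_zero]))
      refine ⟨⟨y, ?_⟩, hy⟩
      apply inj (n + 1) (Submodule.map μ.toLinearMap (SymPow P ι 2)).subtype
        (Submodule.subtype_injective _)
      have hzero : μ.toLinearMap ∘ₗ (SymPow P ι 2 ⊓ LinearMap.ker μ.toLinearMap).subtype = 0 := by
        ext f
        exact f.2.2
      rw [← nat1, map_zero]
      change LinearMap.lTensor _ _ (koszulDifferential b ι _) = 0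
      rw [hy]
      simp only [LinearMap.lTensor, ← LinearMap.comp_apply, ← TensorProduct.map_comp, hzero,
        TensorProduct.map_zero_right, LinearMap.zero_apply]
  obtain ⟨θ, hθ, hker⟩ := LinearMap.exists_surjective_of_range_eq _ _
    (fun x y hxy => Subtype.ext (inj (n + 1) _ (Submodule.subtype_injective _) hxy)) hrange
  refine ⟨θ, hθ, hker.trans ?_⟩
  ext ⟨y, hy⟩
  simp only [LinearMap.mem_ker, LinearMap.comp_apply, Submodule.subtype_apply,
    Submodule.mem_comap]
  constructor
  · intro h
    obtain ⟨t, ht⟩ := exists_koszulDifferential_eq b ι D hD (n + 2) 1 one_ne_zero ι hι1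
      (Algebra.linearMap ℂ P) (fun i w => ⟨b.coord i w, (hD i w).symm⟩) y h
    exact ⟨TensorProduct.rid ℂ _ t, inj (n + 2) ι hιinj ((nat0 t).symm.trans ht)⟩
  · rintro ⟨x, rfl⟩
    have := nat0 ((TensorProduct.rid ℂ _).symm x)
    rw [LinearEquiv.apply_symm_apply] at this
    rw [← this, hdd]
end
end
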